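/- arXiv:1204.5395 — 3 statements merged into one kernel-verified Lean document; each statement's English description precedes it below -/
import Mathlib

section
/- Let A be a monoid with zero and M a finite A-module over F₁. Then there exists a finite internal decomposition of M into indecomposable submodules, and it is unique: if {S_i} and {T_j} are two internal decompositions of M all of whose members are indecomposable, then they coincide as (finite) sets of submodules of M. -/
/-- A submodule of an `A`-module `M` over `F₁`: a subset containing the basepoint `0`
and closed under the `A`-action. -/
def IsSubmod (A : Type*) {M : Type*} [Zero M] [SMul A M] (S : Set M) : Prop :=
  (0 : M) ∈ S ∧ ∀ (a : A) (m : M), m ∈ S → a • m ∈ S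

/-- A submodule `S` is indecomposable if `S ≠ {0}` and in every internal decomposition
of `S` into two submodules `T`, `U` (i.e. `T ∪ U = S` and `T ∩ U = {0}`),
either `T = {0}` or `U = {0}`. -/
def Indecomp (A : Type*) {M : Type*} [Zero M] [SMul A M] (S : Set M) : Prop :=
  S ≠ {0} ∧ ∀ T U : Set M, IsSubmod A T → IsSubmod A U → T ∪ U = S → T ∩ U = {0} →
    T = {0} ∨ U = {0}

/-- A finite internal decomposition of `M` into indecomposable submodules: a finite
set `𝒮` of indecomposable submodules whose union (together with the basepoint) is all
of `M`, with pairwise intersections `{0}`. -/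
def IsDecomp (A : Type*) {M : Type*} [Zero M] [SMul A M] (𝒮 : Finset (Set M)) : Prop :=
  (∀ S ∈ 𝒮, IsSubmod A S ∧ Indecomp A S) ∧
    (⋃₀ (𝒮 : Set (Set M))) ∪ {0} = Set.univ ∧
    ∀ S ∈ 𝒮, ∀ T ∈ 𝒮, S ≠ T → S ∩ T = {0}

section Submodules

variable {A M : Type*}

theorem IsSubmod.inter [Zero M] [SMul A M] {S T : Set M} (hS : IsSubmod A S)
    (hT : IsSubmod A T) : IsSubmod A (S ∩ T) :=
  ⟨⟨hS.1, hT.1⟩, fun a m hm => ⟨hS.2 a m hm.1, hT.2 a m hm.2⟩⟩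

theorem isSubmod_sUnion_union_zero [Zero M] [SMulZeroClass A M] {𝒮 : Set (Set M)}
    (h𝒮 : ∀ S ∈ 𝒮, IsSubmod A S) : IsSubmod A (⋃₀ 𝒮 ∪ {0}) := by
  refine ⟨Or.inr rfl, fun a m hm => ?_⟩
  rcases hm with ⟨S, hS, hm⟩ | rfl
  · exact Or.inl ⟨S, hS, (h𝒮 S hS).2 a m hm⟩
  · exact Or.inr (smul_zero a)

/-- Every submodule of a finite module is a finite union of indecomposable submodules
with pairwise trivial intersections. -/
theorem IsSubmod.exists_indecomp_decomposition [Zero M] [SMul A M] [Finite M]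
    {S : Set M} (hS : IsSubmod A S) :
    ∃ 𝒮 : Finset (Set M), (∀ T ∈ 𝒮, IsSubmod A T ∧ Indecomp A T) ∧
      ⋃₀ (𝒮 : Set (Set M)) ∪ {0} = S ∧ ∀ T ∈ 𝒮, ∀ U ∈ 𝒮, T ≠ U → T ∩ U = {0} := by
  classical
  induction S using WellFoundedLT.induction with
  | ind S ih =>
  by_cases hS0 : S = {0}
  · exact ⟨∅, by simp, by simp [hS0], by simp⟩
  by_cases hInd : Indecomp A S
  · exact ⟨{S}, by simp [hS, hInd], by simp [hS.1], by simp⟩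
  simp only [Indecomp, not_and, not_forall, not_or] at hInd
  obtain ⟨T, U, hT, hU, rfl, hTU, hT0, hU0⟩ := hInd hS0
  have hTlt : T < T ∪ U := by
    refine lt_of_le_of_ne Set.subset_union_left fun h => hU0 ?_
    rw [← hTU, Set.inter_eq_right.2 (Set.union_eq_left.1 h.symm)]
  have hUlt : U < T ∪ U := by
    refine lt_of_le_of_ne Set.subset_union_right fun h => hT0 ?_
    rw [← hTU, Set.inter_eq_left.2 (Set.union_eq_right.1 h.symm)]
  obtain ⟨𝒯, h𝒯, h𝒯T, h𝒯disj⟩ := ih T hTlt hT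
  obtain ⟨𝒰, h𝒰, h𝒰U, h𝒰disj⟩ := ih U hUlt hU
  have cross : ∀ P ∈ 𝒯, ∀ Q ∈ 𝒰, P ∩ Q = {0} := by
    intro P hP Q hQ
    refine Set.Subset.antisymm ?_
      (Set.singleton_subset_iff.2 ⟨(h𝒯 P hP).1.1, (h𝒰 Q hQ).1.1⟩)
    rw [← hTU, ← h𝒯T, ← h𝒰U]
    exact fun x hx => ⟨Or.inl ⟨P, hP, hx.1⟩, Or.inl ⟨Q, hQ, hx.2⟩⟩
  refine ⟨𝒯 ∪ 𝒰, ?_, ?_, ?_⟩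
  · intro P hP
    exact (Finset.mem_union.1 hP).elim (h𝒯 P) (h𝒰 P)
  · rw [← h𝒯T, ← h𝒰U, Finset.coe_union, Set.sUnion_union, Set.union_union_distrib_right]
  · intro P hP Q hQ hPQ
    rcases Finset.mem_union.1 hP with hP | hP <;> rcases Finset.mem_union.1 hQ with hQ | hQ
    · exact h𝒯disj P hP Q hQ hPQ
    · exact cross P hP Q hQ
    · rw [Set.inter_comm]
      exact cross Q hQ P hP
    · exact h𝒰disj P hP Q hQ hPQ

/-- An indecomposable submodule meeting a member of a decomposition nontrivially is
contained in it. -/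
theorem IsDecomp.subset_of_inter_ne [Zero M] [SMulZeroClass A M] {𝒯 : Finset (Set M)}
    (h𝒯 : IsDecomp A 𝒯) {S T : Set M} (hS : IsSubmod A S) (hSind : Indecomp A S)
    (hT : T ∈ 𝒯) (hST : S ∩ T ≠ {0}) : S ⊆ T := by
  obtain ⟨hmem, hcov, hdisj⟩ := h𝒯
  have hR : IsSubmod A (⋃₀ ((𝒯 : Set (Set M)) \ {T}) ∪ {0}) :=
    isSubmod_sUnion_union_zero fun U hU => (hmem U hU.1).1
  set R := ⋃₀ ((𝒯 : Set (Set M)) \ {T}) ∪ {0} with hRdef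
  have hTR : T ∪ R = Set.univ := by
    rw [hRdef, ← Set.union_assoc, ← Set.sUnion_insert, Set.insert_sdiff_singleton,
      Set.insert_eq_of_mem (Finset.mem_coe.2 hT), hcov]
  have hinter : (S ∩ T) ∩ (S ∩ R) = {0} := by
    refine Set.Subset.antisymm ?_
      (Set.singleton_subset_iff.2 ⟨⟨hS.1, (hmem T hT).1.1⟩, hS.1, hR.1⟩)
    rintro x ⟨⟨-, hxT⟩, -, ⟨U, ⟨hU, hUT⟩, hxU⟩ | hx⟩
    · rw [← hdisj U hU T hT hUT]
      exact ⟨hxU, hxT⟩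
    · exact hx
  have hunion : (S ∩ T) ∪ (S ∩ R) = S := by
    rw [← Set.inter_union_distrib_left, hTR, Set.inter_univ]
  have hSR : S ∩ R = {0} :=
    (hSind.2 _ _ (hS.inter (hmem T hT).1) (hS.inter hR) hunion hinter).resolve_left hST
  have h0 : {0} ⊆ S ∩ T := Set.singleton_subset_iff.2 ⟨hS.1, (hmem T hT).1.1⟩
  rw [hSR, Set.union_eq_left.2 h0] at hunion
  exact Set.inter_eq_left.1 hunion

theorem IsDecomp.subset [Zero M] [SMulZeroClass A M] {𝒮 𝒯 : Finset (Set M)}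
    (h𝒮 : IsDecomp A 𝒮) (h𝒯 : IsDecomp A 𝒯) : 𝒮 ⊆ 𝒯 := by
  intro S hS
  obtain ⟨hSsub, hSind⟩ := h𝒮.1 S hS
  obtain ⟨x, hxS, hx0⟩ : ∃ x ∈ S, x ≠ 0 := by
    by_contra! h
    exact hSind.1 (Set.Subset.antisymm h (Set.singleton_subset_iff.2 hSsub.1))
  obtain ⟨T, hT, hxT⟩ : x ∈ ⋃₀ (𝒯 : Set (Set M)) :=
    (h𝒯.2.1 ▸ Set.mem_univ x : x ∈ ⋃₀ (𝒯 : Set (Set M)) ∪ {0}).resolve_right hx0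
  obtain ⟨hTsub, hTind⟩ := h𝒯.1 T hT
  have hST : S ∩ T ≠ {0} := fun h => hx0 (h.subset ⟨hxS, hxT⟩)
  have hEq : S = T := Set.Subset.antisymm (h𝒯.subset_of_inter_ne hSsub hSind hT hST)
    (h𝒮.subset_of_inter_ne hTsub hTind hS (Set.inter_comm S T ▸ hST))
  exact hEq ▸ hT

end Submodules

/-- **Krull–Schmidt for finite modules over `F₁`.**  Every finite `A`-module `M` admits a
finite internal decomposition into indecomposable submodules, and any two such
decompositions coincide as sets of submodules of `M`. -/
theorem exists_unique_decomposition_into_indecomposables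
    (A M : Type*) [MonoidWithZero A] [Zero M] [MulActionWithZero A M] [Finite M] :
    (∃ 𝒮 : Finset (Set M), IsDecomp A 𝒮) ∧
      ∀ 𝒮 𝒯 : Finset (Set M), IsDecomp A 𝒮 → IsDecomp A 𝒯 → 𝒮 = 𝒯 := by
  refine ⟨?_, fun 𝒮 𝒯 h𝒮 h𝒯 => (h𝒮.subset h𝒯).antisymm (h𝒯.subset h𝒮)⟩
  exact IsSubmod.exists_indecomp_decomposition (A := A) (S := (Set.univ : Set M))
    ⟨Set.mem_univ _, fun _ _ _ => Set.mem_univ _⟩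
end

section
/- Let (M, f) be a finite F⟨t⟩-module over F₁. For a submodule N of M define Φ_N := {m ∈ M | m ∉ N, f(m) ∈ N, f(m) ≠ 0}, and for an admissible cut Φ define N_Φ := {m ∈ M | f^k(m) ∉ Φ for all k ≥ 0}. Then: (1) for every submodule N, the set Φ_N is an admissible cut; (2) for every admissible cut Φ, the set N_Φ is a submodule of M; and (3) Φ_{N_Φ} = Φ for every admissible cut Φ. In particular Φ ↦ N_Φ is an injection from admissible cuts on Γ_M into submodules of M. -/
/-- A submodule of an `F⟨t⟩`-module `(M, f)`: a subset containing `0` and closed under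
`f`. -/
def IsSubmoduleF {M : Type*} [Zero M] (f : M → M) (N : Set M) : Prop :=
  (0 : M) ∈ N ∧ ∀ m ∈ N, f m ∈ N

/-- An admissible cut on `Γ_M`: a set `Φ` of edges (identified with their source
vertices, i.e. elements `m` with `m ≠ 0` and `f m ≠ 0`) such that no oriented path
contains two edges of `Φ`. -/
def IsAdmissibleCut {M : Type*} [Zero M] (f : M → M) (Φ : Set M) : Prop :=
  (∀ m ∈ Φ, m ≠ 0 ∧ f m ≠ 0) ∧ ∀ m ∈ Φ, ∀ k : ℕ, 1 ≤ k → f^[k] m ∉ Φ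

/-- The cut `Φ_N` associated to a submodule `N`. -/
def cutOf {M : Type*} [Zero M] (f : M → M) (N : Set M) : Set M :=
  {m | m ∉ N ∧ f m ∈ N ∧ f m ≠ 0}

/-- The submodule `N_Φ` associated to an admissible cut `Φ`. -/
def submoduleOf {M : Type*} [Zero M] (f : M → M) (Φ : Set M) : Set M :=
  {m | ∀ k : ℕ, f^[k] m ∉ Φ}

theorem IsSubmoduleF.iterate_mem {M : Type*} [Zero M] {f : M → M} {N : Set M}
    (hN : IsSubmoduleF f N) {m : M} (hm : m ∈ N) (k : ℕ) : f^[k] m ∈ N := by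
  induction k with
  | zero => exact hm
  | succ k ih => rw [Function.iterate_succ_apply']; exact hN.2 _ ih

theorem IsSubmoduleF.isAdmissibleCut_cutOf {M : Type*} [Zero M] {f : M → M} {N : Set M}
    (hN : IsSubmoduleF f N) : IsAdmissibleCut f (cutOf f N) := by
  refine ⟨fun m hm => ⟨fun h => hm.1 (h ▸ hN.1), hm.2.2⟩, fun m hm k hk hmem => hmem.1 ?_⟩
  obtain ⟨j, rfl⟩ := Nat.exists_eq_add_of_le' hk
  exact hN.iterate_mem hm.2.1 j

theorem IsAdmissibleCut.isSubmoduleF_submoduleOf {M : Type*} [Zero M] {f : M → M}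
    (hf : f 0 = 0) {Φ : Set M} (hΦ : IsAdmissibleCut f Φ) :
    IsSubmoduleF f (submoduleOf f Φ) := by
  refine ⟨fun k hk => ?_, fun m hm k => hm (k + 1)⟩
  rw [Function.iterate_fixed hf] at hk
  exact (hΦ.1 0 hk).1 rfl

theorem IsAdmissibleCut.cutOf_submoduleOf {M : Type*} [Zero M] {f : M → M} {Φ : Set M}
    (hΦ : IsAdmissibleCut f Φ) : cutOf f (submoduleOf f Φ) = Φ := by
  ext m
  constructor
  · rintro ⟨hm, hfm, -⟩
    by_contra h
    refine hm fun k => ?_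
    cases k with
    | zero => exact h
    | succ k => exact hfm k
  · intro hm
    exact ⟨fun h => h 0 hm, fun k => hΦ.2 m hm (k + 1) (Nat.le_add_left 1 k), (hΦ.1 m hm).2⟩

/-- For a finite `F⟨t⟩`-module `(M, f)`: (1) for every submodule `N`, the set `Φ_N` is
an admissible cut; (2) for every admissible cut `Φ`, the set `N_Φ` is a submodule;
(3) `Φ_{N_Φ} = Φ` for every admissible cut `Φ`.  In particular `Φ ↦ N_Φ` is an
injection from admissible cuts on `Γ_M` into submodules of `M`. -/
theorem submodules_and_admissible_cuts {M : Type*} [Zero M] [Finite M] (f : M → M)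
    (hf : f 0 = 0) :
    (∀ N : Set M, IsSubmoduleF f N → IsAdmissibleCut f (cutOf f N)) ∧
      (∀ Φ : Set M, IsAdmissibleCut f Φ → IsSubmoduleF f (submoduleOf f Φ)) ∧
      (∀ Φ : Set M, IsAdmissibleCut f Φ → cutOf f (submoduleOf f Φ) = Φ) ∧
      (∀ Φ Φ' : Set M, IsAdmissibleCut f Φ → IsAdmissibleCut f Φ' →
        submoduleOf f Φ = submoduleOf f Φ' → Φ = Φ') := by
  exact ⟨fun _ hN => hN.isAdmissibleCut_cutOf, fun _ hΦ => hΦ.isSubmoduleF_submoduleOf hf,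
    fun _ hΦ => hΦ.cutOf_submoduleOf, fun _ _ hΦ hΦ' h => by
      rw [← hΦ.cutOf_submoduleOf, h, hΦ'.cutOf_submoduleOf]⟩
end

section
/- Every additive congruence on the monoid ℕ of natural numbers is either the equality relation, or there exist n ≥ 0 and d ≥ 1 such that the congruence relates a and b if and only if a = b, or (n ≤ a and n ≤ b and a ≡ b (mod d)). -/
/-- A relation between `n` and `n + d` makes the congruence `d`-periodic from `n` on. -/
theorem AddCon.nat_rel_add_mul {c : AddCon ℕ} {n d : ℕ} (h : c n (n + d)) {a : ℕ}
    (ha : n ≤ a) (k : ℕ) : c a (a + d * k) := by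
  induction k with
  | zero => exact c.refl a
  | succ k ih =>
    have h' := c.add h (c.refl (a + d * k - n))
    rw [show n + (a + d * k - n) = a + d * k by omega,
      show n + d + (a + d * k - n) = a + d * (k + 1) by rw [mul_add]; omega] at h'
    exact c.trans ih h'

/-- If the congruence is periodic from `n` on, then any later period is already a period at `n`. -/
theorem AddCon.nat_rel_add_of_rel_add {c : AddCon ℕ} {n d : ℕ} (hd : 1 ≤ d)
    (h : c n (n + d)) {a e : ℕ} (hae : c a (a + e)) : c n (n + e) := by
  have h₁ : c n (n + d * a) := nat_rel_add_mul h le_rfl a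
  have hle : a ≤ n + d * a := le_add_left (Nat.le_mul_of_pos_left a hd)
  have h₂ : c (n + d * a) (n + d * a + e) := by
    simpa using nat_rel_add_mul hae hle 1
  have h₃ : c (n + e) (n + d * a + e) := c.add h₁ (c.refl e)
  exact c.trans (c.trans h₁ h₂) (c.symm h₃)

/-- The least period at `n` divides every period at `n`. -/
theorem AddCon.nat_dvd_of_rel_add {c : AddCon ℕ} {n d : ℕ} (hd : 1 ≤ d) (h : c n (n + d))
    (hmin : ∀ e, 1 ≤ e → c n (n + e) → d ≤ e) {e : ℕ} (he : c n (n + e)) : d ∣ e := by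
  have h₁ : c (n + e % d) (n + e) := by
    simpa [add_assoc, Nat.mod_add_div] using
      nat_rel_add_mul h (Nat.le_add_right n (e % d)) (e / d)
  have h₂ : c n (n + e % d) := c.trans he (c.symm h₁)
  by_contra hde
  have hpos : 1 ≤ e % d := Nat.pos_of_ne_zero fun h₀ => hde (Nat.dvd_of_mod_eq_zero h₀)
  exact absurd (hmin _ hpos h₂) (Nat.mod_lt e hd).not_ge

/-- **Classification of additive congruences on ℕ.**  Every additive congruence on the
monoid `ℕ` is either the equality relation, or there exist `n ≥ 0` and `d ≥ 1` such
that it relates `a` and `b` iff `a = b`, or `n ≤ a`, `n ≤ b` and `a ≡ b (mod d)`. -/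
theorem addCon_nat_classification (c : AddCon ℕ) :
    (∀ a b : ℕ, c a b ↔ a = b) ∨
      ∃ n d : ℕ, 1 ≤ d ∧
        ∀ a b : ℕ, c a b ↔ (a = b ∨ (n ≤ a ∧ n ≤ b ∧ a % d = b % d)) := by
  classical
  by_cases hex : ∃ n d : ℕ, 1 ≤ d ∧ c n (n + d)
  · right
    obtain ⟨n, hn, hnmin⟩ : ∃ n, (∃ d, 1 ≤ d ∧ c n (n + d)) ∧
        ∀ m, (∃ d, 1 ≤ d ∧ c m (m + d)) → n ≤ m :=
      ⟨Nat.find hex, Nat.find_spec hex, fun _ hm => Nat.find_min' hex hm⟩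
    obtain ⟨d, ⟨hd, hnd⟩, hdmin⟩ : ∃ d, (1 ≤ d ∧ c n (n + d)) ∧
        ∀ e, 1 ≤ e → c n (n + e) → d ≤ e :=
      ⟨Nat.find hn, Nat.find_spec hn, fun _ h₁ h₂ => Nat.find_min' hn ⟨h₁, h₂⟩⟩
    refine ⟨n, d, hd, fun a b => ?_⟩
    wlog hab : a ≤ b generalizing a b
    · have hba := this b a (le_of_not_ge hab)
      rw [show c a b ↔ c b a from ⟨c.symm, c.symm⟩, hba]
      constructor <;> rintro (h | ⟨h₁, h₂, h₃⟩) <;> simp_all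
    obtain ⟨e, rfl⟩ := Nat.exists_eq_add_of_le hab
    constructor
    · intro h
      rcases Nat.eq_zero_or_pos e with rfl | he
      · exact Or.inl rfl
      · have hna : n ≤ a := hnmin a ⟨e, he, h⟩
        obtain ⟨k, rfl⟩ := AddCon.nat_dvd_of_rel_add hd hnd hdmin
          (AddCon.nat_rel_add_of_rel_add hd hnd h)
        exact Or.inr ⟨hna, by omega, by simp⟩
    · rintro (h | ⟨hna, -, hmod⟩)
      · rw [← h]
        exact c.refl a
      · obtain ⟨k, hk⟩ := (Nat.modEq_iff_dvd' hab).mp hmod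
        rw [Nat.add_sub_cancel_left] at hk
        rw [hk]
        exact AddCon.nat_rel_add_mul hnd hna k
  · left
    push Not at hex
    have hle : ∀ {a b : ℕ}, c a b → b ≤ a := fun {a b} h => by
      by_contra! hab
      apply hex a (b - a) (by omega)
      rwa [Nat.add_sub_cancel' hab.le]
    exact fun a b => ⟨fun h => le_antisymm (hle (c.symm h)) (hle h), fun h => h ▸ c.refl a⟩
end
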